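/- arXiv:2402.04428 — 2 statements merged into one kernel-verified Lean document; each statement's English description precedes it below -/
import Mathlib

section
/- Let a, b, c be integers greater than 1 with a even and gcd(a,b) = 1. Set γ = ν₂(a) and δ = ν₂(b² − 1) − 1. Suppose (x₁,y₁,z₁) and (x₂,y₂,z₂) are two distinct triples of positive integers with a^{x₁} + b^{y₁} = c^{z₁} and a^{x₂} + b^{y₂} = c^{z₂}, and suppose x₁ ≤ x₂. Then γ·x₁ < δ + (1/log 2)·log( (log c / log b) · z₁ · z₂ ), where log denotes the natural logarithm. -/
/-- For odd `b`, the 2-adic valuation of `b ^ n - 1` is at most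
`ν₂(b ^ 2 - 1) - 1 + ν₂(n)`. -/
theorem le_of_two_pow_dvd_pow_sub_one {b n m : ℕ} (hb : 1 < b) (hodd : Odd b) (hn : n ≠ 0)
    (h : 2 ^ m ∣ b ^ n - 1) :
    m ≤ padicValNat 2 (b ^ 2 - 1) - 1 + padicValNat 2 n := by
  have key := padicValNat.pow_two_sub_pow (x := b) (y := 1) hb
    (by obtain ⟨k, rfl⟩ := hodd; exact ⟨k, by omega⟩) hodd.not_two_dvd_nat
    (n := 2 * n) (by omega) (even_two_mul n)
  have hpow : 1 < b ^ n := Nat.one_lt_pow hn hb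
  have hsq : b ^ 2 - 1 = (b + 1) * (b - 1) := by simpa using Nat.sq_sub_sq b 1
  have hval : padicValNat 2 (b ^ 2 - 1) = padicValNat 2 (b + 1) + padicValNat 2 (b - 1) := by
    rw [hsq, padicValNat.mul (by omega) (by omega)]
  have hdouble : b ^ (2 * n) - 1 = (b ^ n + 1) * (b ^ n - 1) := by
    rw [mul_comm, pow_mul]; simpa using Nat.sq_sub_sq (b ^ n) 1
  have hdvd : 2 ^ (m + 1) ∣ b ^ (2 * n) - 1 := by
    rw [hdouble, pow_succ, mul_comm]
    exact mul_dvd_mul (hodd.pow.add_one).two_dvd h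
  have hne : b ^ (2 * n) - 1 ≠ 0 := by
    have := Nat.one_lt_pow (show 2 * n ≠ 0 by omega) hb
    omega
  have hle := (padicValNat_dvd_iff_le hne).1 hdvd
  rw [one_pow, padicValNat.mul (by norm_num) hn, padicValNat.self (by norm_num)] at key
  omega

theorem three_le_padicValNat_sq_sub_one {b : ℕ} (hb : 1 < b) (hodd : Odd b) :
    3 ≤ padicValNat 2 (b ^ 2 - 1) := by
  have hne : b ^ 2 - 1 ≠ 0 := by
    have := Nat.one_lt_pow two_ne_zero hb
    omega
  refine (padicValNat_dvd_iff_le hne).1 ?_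
  exact Nat.eight_dvd_sq_sub_one_of_odd hodd

theorem pow_sub_pow_strictMono {B C : ℤ} (hB : 1 < B) (hBC : B < C) :
    StrictMono fun n : ℕ => C ^ n - B ^ n := by
  refine strictMono_nat_of_lt_succ fun n => ?_
  have h1 : B ^ n ≤ C ^ n := pow_le_pow_left₀ (by omega) hBC.le n
  have h2 : 0 < B ^ n := by positivity
  simp only [pow_succ]
  nlinarith [mul_le_mul_of_nonneg_right h1 (show 0 ≤ C - 1 by omega),
    mul_pos h2 (show 0 < C - B by omega)]

/-- If, for odd `B < C`, both `C ^ s - B ^ s` and `C ^ t - B ^ t` are powers of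
an even number `a` coprime to `B`, and `s`, `t` are coprime and distinct, then the smaller
power is not divisible by `4`. -/
theorem padicValNat_mul_le_one_of_pow_sub_pow_eq {a s t x₁ x₂ : ℕ} {B C : ℤ}
    (ha : 1 < a) (haeven : Even a) (hB : 1 < B) (hBC : B < C) (hBodd : Odd B) (hCodd : Odd C)
    (hcop : IsCoprime (a : ℤ) B)
    (hst : Nat.Coprime s t) (hne : s ≠ t) (hx₁ : x₁ ≠ 0) (hx : x₁ ≤ x₂)
    (h₁ : C ^ s - B ^ s = (a : ℤ) ^ x₁) (h₂ : C ^ t - B ^ t = (a : ℤ) ^ x₂) :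
    padicValNat 2 a * x₁ ≤ 1 := by
  have h2C : ¬ (2 : ℤ) ∣ C := by
    rw [← even_iff_two_dvd]; exact Int.not_even_iff_odd.2 hCodd
  have h2CB : (2 : ℤ) ∣ C - B := (hCodd.sub_odd hBodd).two_dvd
  have hlift : ∀ {n : ℕ}, Odd n → ∀ {m : ℕ}, (2 : ℤ) ^ m ∣ C ^ n - B ^ n →
      (2 : ℤ) ^ m ∣ C - B := by
    intro n hn m hm
    have h2n : ¬ (2 : ℤ) ∣ n := by exact_mod_cast hn.not_two_dvd_nat
    rwa [pow_dvd_iff_le_emultiplicity,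
      emultiplicity_pow_sub_pow_of_prime Int.prime_two h2CB h2C h2n,
      ← pow_dvd_iff_le_emultiplicity] at hm
  have hγ : ∀ x, (2 : ℤ) ^ (padicValNat 2 a * x) ∣ (a : ℤ) ^ x := by
    intro x
    rw [pow_mul]
    exact pow_dvd_pow_of_dvd (by exact_mod_cast pow_padicValNat_dvd (p := 2) (n := a)) x
  have hγpos : 0 < padicValNat 2 a :=
    Nat.pos_of_ne_zero (dvd_iff_padicValNat_ne_zero (by omega) |>.1 haeven.two_dvd)
  rcases Nat.even_or_odd t with ht | ht
  · have hs : Odd s := by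
      by_contra hs
      rw [Nat.not_odd_iff_even] at hs
      have := Nat.dvd_gcd hs.two_dvd ht.two_dvd
      rw [hst] at this
      omega
    have hsum : C + B ∣ (a : ℤ) ^ x₂ := by
      rw [← h₂]
      have := sub_dvd_pow_sub_pow C (-B) t
      rwa [ht.neg_pow, sub_neg_eq_add] at this
    have hprime : ∀ p : ℕ, p.Prime → p ∣ (C + B).natAbs → p = 2 := by
      intro p hp hpd
      have hpz : Prime (p : ℤ) := Nat.prime_iff_prime_int.1 hp
      have hpd' : (p : ℤ) ∣ C + B := Int.natCast_dvd.2 hpd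
      have hpa : (p : ℤ) ∣ a := hpz.dvd_of_dvd_pow (hpd'.trans hsum)
      have hpB : ¬ (p : ℤ) ∣ B := fun h => hpz.not_isUnit (hcop.isUnit_of_dvd' hpa h)
      have hd1 : (p : ℤ) ∣ C ^ s - B ^ s := by
        rw [h₁]; exact hpa.trans (dvd_pow_self _ hx₁)
      have hd2 : (p : ℤ) ∣ C ^ s + B ^ s := hpd'.trans (hs.add_dvd_pow_add_pow _ _)
      have hd3 : (p : ℤ) ∣ 2 * B ^ s := by
        have := dvd_sub hd2 hd1
        rwa [show C ^ s + B ^ s - (C ^ s - B ^ s) = 2 * B ^ s by ring] at this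
      rcases hpz.dvd_or_dvd hd3 with h | h
      · exact (Nat.prime_dvd_prime_iff_eq hp Nat.prime_two).1 (by exact_mod_cast h)
      · exact absurd (hpz.dvd_of_dvd_pow h) hpB
    obtain ⟨k, hk⟩ : ∃ k, (C + B).natAbs = 2 ^ k :=
      ⟨_, Nat.eq_prime_pow_of_unique_prime_dvd (by omega) fun {d} => hprime d⟩
    have hk2 : 2 ≤ k := by
      by_contra hlt
      have : k = 0 ∨ k = 1 := by omega
      rcases this with rfl | rfl <;> omega
    have h4 : (4 : ℤ) ∣ C + B := by
      have : 2 ^ 2 ∣ (C + B).natAbs := hk ▸ pow_dvd_pow 2 hk2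
      exact Int.natCast_dvd.2 this
    by_contra hgt
    have h4' : (4 : ℤ) ∣ C - B := by
      refine hlift (m := 2) hs ?_
      rw [h₁]
      exact (pow_dvd_pow 2 (by omega)).trans (hγ x₁)
    obtain ⟨l, rfl⟩ := hBodd
    omega
  · exfalso
    have hd : (2 : ℤ) ^ (padicValNat 2 a * x₂) ∣ (a : ℤ) ^ x₁ := by
      rw [← h₁]
      exact (hlift ht (h₂ ▸ hγ x₂)).trans (sub_dvd_pow_sub_pow C B s)
    have hd' : 2 ^ (padicValNat 2 a * x₂) ∣ a ^ x₁ := by exact_mod_cast hd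
    have hle := (padicValNat_dvd_iff_le (pow_ne_zero _ (by omega))).1 hd'
    rw [padicValNat.pow, mul_comm x₁] at hle
    have hxx : x₁ = x₂ := le_antisymm hx (Nat.le_of_mul_le_mul_left hle hγpos)
    subst hxx
    exact hne ((pow_sub_pow_strictMono hB hBC).injective (h₁.trans h₂.symm))

/-- If `b ^ u ≡ b ^ v` modulo `2 ^ m` with `u ≠ v` and `b` odd, then `m` is bounded in terms of
any strict upper bound of `u` and `v`. -/
theorem lt_add_log_of_pow_modEq {b u v m : ℕ} {R : ℝ} (hb : 1 < b) (hodd : Odd b) (huv : u < v)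
    (hv : (v : ℝ) < R) (h : b ^ u ≡ b ^ v [MOD 2 ^ m]) :
    (m : ℝ) < ((padicValNat 2 (b ^ 2 - 1) - 1 : ℕ) : ℝ) + (1 / Real.log 2) * Real.log R := by
  have hn : v - u ≠ 0 := by omega
  have hdvd : 2 ^ m ∣ b ^ (v - u) - 1 := by
    have h' := (Nat.modEq_iff_dvd' (Nat.pow_le_pow_right (by omega) huv.le)).1 h
    have hfac : b ^ v - b ^ u = b ^ u * (b ^ (v - u) - 1) := by
      rw [Nat.mul_sub, ← pow_add, mul_one, Nat.add_sub_cancel' huv.le]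
    rw [hfac] at h'
    exact (Nat.Coprime.pow m u (Nat.coprime_two_left.2 hodd)).dvd_of_dvd_mul_left h'
  have hm := le_of_two_pow_dvd_pow_sub_one hb hodd hn hdvd
  have hpow : 2 ^ padicValNat 2 (v - u) ≤ v - u :=
    Nat.le_of_dvd (by omega) pow_padicValNat_dvd
  have hlt : (2 : ℝ) ^ padicValNat 2 (v - u) < R := by
    refine lt_of_le_of_lt ?_ hv
    exact_mod_cast hpow.trans (Nat.sub_le _ _)
  have hlog := Real.log_lt_log (by positivity) hlt
  rw [Real.log_pow] at hlog
  have hlog2 : 0 < Real.log 2 := Real.log_pos one_lt_two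
  have hval : (padicValNat 2 (v - u) : ℝ) < (1 / Real.log 2) * Real.log R := by
    rw [one_div, inv_mul_eq_div, lt_div_iff₀ hlog2]
    exact hlog
  have hm' : (m : ℝ) ≤ ((padicValNat 2 (b ^ 2 - 1) - 1 : ℕ) : ℝ) + padicValNat 2 (v - u) := by
    exact_mod_cast hm
  linarith

theorem pow_modEq_of_add_eq {a b c x y z k : ℕ} (h : a ^ x + b ^ y = c ^ z) {M : ℕ}
    (hM : M ∣ a ^ x) : b ^ (y * k) ≡ c ^ (z * k) [MOD M] := by
  rw [pow_mul, pow_mul, ← h]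
  refine Nat.ModEq.pow k ?_
  simpa using ((Nat.modEq_zero_iff_dvd.2 hM).symm.add_right (b ^ y))

theorem exponent_lt_log_ratio_mul {a b c x y z : ℕ} (ha : 0 < a) (hb : 1 < b)
    (h : a ^ x + b ^ y = c ^ z) : (y : ℝ) < Real.log c / Real.log b * z := by
  have hlogb : 0 < Real.log b := Real.log_pos (by exact_mod_cast hb)
  have hlt : (b : ℝ) ^ y < (c : ℝ) ^ z := by
    have : 0 < a ^ x := by positivity
    exact_mod_cast (show b ^ y < c ^ z by omega)
  have hlog := Real.log_lt_log (pow_pos (by exact_mod_cast (by omega : 0 < b)) y) hlt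
  rw [Real.log_pow, Real.log_pow] at hlog
  rw [div_mul_eq_mul_div, lt_div_iff₀ hlogb]
  linarith

theorem lemma3_two_adic_bound
    (a b c : ℕ) (ha : 1 < a) (hb : 1 < b) (hc : 1 < c)
    (haeven : Even a) (hab : Nat.Coprime a b)
    (γ δ : ℕ) (hγ : γ = padicValNat 2 a) (hδ : δ = padicValNat 2 (b ^ 2 - 1) - 1)
    (x₁ y₁ z₁ x₂ y₂ z₂ : ℕ)
    (hx₁ : 0 < x₁) (hy₁ : 0 < y₁) (hz₁ : 0 < z₁)
    (hx₂ : 0 < x₂) (hy₂ : 0 < y₂) (hz₂ : 0 < z₂)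
    (hne : (x₁, y₁, z₁) ≠ (x₂, y₂, z₂))
    (heq₁ : a ^ x₁ + b ^ y₁ = c ^ z₁) (heq₂ : a ^ x₂ + b ^ y₂ = c ^ z₂)
    (hx : x₁ ≤ x₂) :
    (γ : ℝ) * x₁ < (δ : ℝ) +
      (1 / Real.log 2) * Real.log ((Real.log c / Real.log b) * z₁ * z₂) := by
  have hbodd : Odd b := Nat.coprime_two_left.1 (hab.coprime_dvd_left haeven.two_dvd)
  have hR₁ : ((y₁ * z₂ : ℕ) : ℝ) < Real.log c / Real.log b * z₁ * z₂ := by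
    push_cast
    exact mul_lt_mul_of_pos_right (exponent_lt_log_ratio_mul (by omega) hb heq₁)
      (by exact_mod_cast hz₂)
  have hR₂ : ((y₂ * z₁ : ℕ) : ℝ) < Real.log c / Real.log b * z₁ * z₂ := by
    push_cast
    rw [mul_right_comm]
    exact mul_lt_mul_of_pos_right (exponent_lt_log_ratio_mul (by omega) hb heq₂)
      (by exact_mod_cast hz₁)
  have hpow₁ : 2 ^ (γ * x₁) ∣ a ^ x₁ := by
    rw [hγ, pow_mul]
    exact pow_dvd_pow_of_dvd pow_padicValNat_dvd x₁
  have hmod : b ^ (y₁ * z₂) ≡ b ^ (y₂ * z₁) [MOD 2 ^ (γ * x₁)] := by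
    have h₁ := pow_modEq_of_add_eq (k := z₂) heq₁ hpow₁
    have h₂ := pow_modEq_of_add_eq (k := z₁) heq₂ (hpow₁.trans (pow_dvd_pow a hx))
    rw [mul_comm z₂] at h₂
    exact h₁.trans h₂.symm
  rcases lt_trichotomy (y₁ * z₂) (y₂ * z₁) with hlt | heq | hlt
  · have := lt_add_log_of_pow_modEq hb hbodd hlt hR₂ hmod
    rw [hδ]
    exact_mod_cast this
  · have hle : γ * x₁ ≤ 1 := by
      obtain ⟨s, t, hst, hs, ht⟩ := Nat.exists_coprime z₁ z₂
      set d := Nat.gcd z₁ z₂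
      have hd : 0 < d := Nat.gcd_pos_of_pos_left _ hz₁
      have hs0 : 0 < s := Nat.pos_of_ne_zero (by rintro rfl; omega)
      have hyt : y₁ * t = y₂ * s := by
        refine Nat.eq_of_mul_eq_mul_right hd ?_
        rw [mul_assoc, mul_assoc, ← hs, ← ht, heq]
      obtain ⟨e, he⟩ : s ∣ y₁ := hst.dvd_of_dvd_mul_right ⟨y₂, by rw [hyt, mul_comm]⟩
      have he₂ : y₂ = t * e := by
        refine Nat.eq_of_mul_eq_mul_right hs0 ?_
        rw [← hyt, he]; ring
      have he0 : e ≠ 0 := by rintro rfl; omega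
      have h₁ : (((c ^ d : ℕ) : ℤ)) ^ s - ((b ^ e : ℕ) : ℤ) ^ s = (a : ℤ) ^ x₁ := by
        rw [sub_eq_iff_eq_add]
        norm_cast
        rw [← pow_mul, ← pow_mul, mul_comm d, ← hs, mul_comm e, ← he, heq₁]
      have h₂ : (((c ^ d : ℕ) : ℤ)) ^ t - ((b ^ e : ℕ) : ℤ) ^ t = (a : ℤ) ^ x₂ := by
        rw [sub_eq_iff_eq_add]
        norm_cast
        rw [← pow_mul, ← pow_mul, mul_comm d, ← ht, mul_comm e, ← he₂, heq₂]
      have hcodd : Odd c := by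
        have hz : Odd (c ^ z₁) := heq₁ ▸ (haeven.pow_of_ne_zero hx₁.ne').add_odd hbodd.pow
        exact (Nat.odd_pow_iff hz₁.ne').1 hz
      have hBC : b ^ e < c ^ d := by
        have hpos : 0 < a ^ x₁ := by positivity
        refine lt_of_pow_lt_pow_left₀ s (Nat.zero_le _) ?_
        have : (b ^ e) ^ s = b ^ y₁ ∧ (c ^ d) ^ s = c ^ z₁ := by
          rw [← pow_mul, ← pow_mul, mul_comm d, ← hs, mul_comm e, ← he]
          exact ⟨rfl, rfl⟩
        omega
      rw [hγ]
      refine padicValNat_mul_le_one_of_pow_sub_pow_eq ha haeven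
        (B := ((b ^ e : ℕ) : ℤ)) (C := ((c ^ d : ℕ) : ℤ))
        (by exact_mod_cast Nat.one_lt_pow he0 hb) (by exact_mod_cast hBC)
        (by exact_mod_cast hbodd.pow) (by exact_mod_cast hcodd.pow)
        (Nat.isCoprime_iff_coprime.2 (hab.pow_right e)) hst ?_ hx₁.ne' hx h₁ h₂
      rintro rfl
      have hz : z₁ = z₂ := hs.trans ht.symm
      have hy : y₁ = y₂ := he.trans he₂.symm
      refine hne ?_
      have hxx : a ^ x₁ = a ^ x₂ := by
        rw [← hy, ← hz] at heq₂
        omega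
      rw [Nat.pow_right_injective ha hxx, hy, hz]
    have hδ2 : 2 ≤ δ := by
      have := three_le_padicValNat_sq_sub_one hb hbodd
      omega
    have hone : (1 : ℝ) ≤ Real.log c / Real.log b * z₁ * z₂ := by
      refine le_trans ?_ hR₁.le
      exact_mod_cast Nat.mul_pos hy₁ hz₂
    have hlog : 0 ≤ (1 / Real.log 2) * Real.log ((Real.log c / Real.log b) * z₁ * z₂) :=
      mul_nonneg (one_div_nonneg.2 (Real.log_nonneg one_le_two)) (Real.log_nonneg hone)
    have h1 : (γ : ℝ) * x₁ ≤ 1 := by exact_mod_cast hle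
    have h2 : (2 : ℝ) ≤ δ := by exact_mod_cast hδ2
    linarith
  · have := lt_add_log_of_pow_modEq hb hbodd hlt hR₁ hmod.symm
    rw [hδ]
    exact_mod_cast this
end

section
/- Let a, b be odd integers greater than 1 with gcd(a,b) = 1 and let c > 1 be an even integer. Set α = min(ν₂(a² − 1) − 1, ν₂(b² − 1) − 1) and β = ν₂(c). Suppose (x₁,y₁,z₁) and (x₂,y₂,z₂) are two distinct triples of positive integers with a^{x₁} + b^{y₁} = c^{z₁} and a^{x₂} + b^{y₂} = c^{z₂}, and suppose z₁ ≤ z₂. Then β·z₁ − log(z₁)/log 2 < α + (1/log 2)·log( (log²(c) / (log a · log b)) · z₂ ), where log denotes the natural logarithm. -/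
theorem pow_mul_eq_or_eq_neg_of_pow_eq_neg {R : Type*} [CommRing R] {a b : R}
    {x₁ y₁ x₂ y₂ : ℕ} (h₁ : a ^ x₁ = -b ^ y₁) (h₂ : a ^ x₂ = -b ^ y₂) :
    a ^ (x₁ * y₂) = a ^ (x₂ * y₁) ∨ a ^ (x₁ * y₂) = -a ^ (x₂ * y₁) := by
  have e₁ : a ^ (x₁ * y₂) = (-1) ^ y₂ * b ^ (y₁ * y₂) := by
    rw [pow_mul, h₁, neg_pow, pow_mul]
  have e₂ : a ^ (x₂ * y₁) = (-1) ^ y₁ * b ^ (y₁ * y₂) := by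
    rw [pow_mul, h₂, neg_pow, mul_comm y₁ y₂, pow_mul]
  rw [e₁, e₂]
  rcases neg_one_pow_eq_or R y₁ with h | h <;> rcases neg_one_pow_eq_or R y₂ with h' | h' <;>
    simp [h, h']

theorem le_padicValNat_of_two_pow_dvd_pow_sub_or_add_one {a d k : ℕ} (ha : 1 < a) (hodd : Odd a)
    (hd : d ≠ 0) (h : (2 : ℤ) ^ k ∣ (a : ℤ) ^ d - 1 ∨ (2 : ℤ) ^ k ∣ (a : ℤ) ^ d + 1) :
    k ≤ padicValNat 2 (a ^ 2 - 1) - 1 + padicValNat 2 d := by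
  have hda : ¬ 2 ∣ a := by
    rw [← even_iff_two_dvd]; exact Nat.not_even_iff_odd.2 hodd
  have hz : Odd ((a : ℤ) ^ d) := Odd.pow (by exact_mod_cast hodd)
  have h2 : (2 : ℤ) ^ (k + 1) ∣ (a : ℤ) ^ (2 * d) - 1 := by
    have e : (a : ℤ) ^ (2 * d) - 1 = ((a : ℤ) ^ d - 1) * ((a : ℤ) ^ d + 1) := by ring
    rw [e, pow_succ]
    rcases h with h | h
    · exact mul_dvd_mul h (hz.add_odd odd_one).two_dvd
    · rw [mul_comm ((a : ℤ) ^ d - 1)]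
      exact mul_dvd_mul h (hz.sub_odd odd_one).two_dvd
  have hlt : 1 < a ^ (2 * d) := Nat.one_lt_pow (by omega) ha
  have h3 : 2 ^ (k + 1) ∣ a ^ (2 * d) - 1 := by
    zify [hlt.le]
    exact h2
  have h4 : k + 1 ≤ padicValNat 2 (a ^ (2 * d) - 1) :=
    (padicValNat_dvd_iff_le (by omega)).1 h3
  have h5 := padicValNat.pow_two_sub_one ha hda (n := 2 * d) (by omega) (even_two_mul d)
  have h6 := padicValNat.pow_two_sub_one ha hda (n := 2) (by omega) even_two
  have h7 : padicValNat 2 (2 * d) = 1 + padicValNat 2 d := by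
    rw [padicValNat.mul (by omega) hd]; simp
  simp only [padicValNat_self] at h6
  omega

theorem le_padicValNat_add_of_two_pow_dvd {a b x₁ y₁ x₂ y₂ k : ℕ} (ha : 1 < a) (hodd : Odd a)
    (h₁ : 2 ^ k ∣ a ^ x₁ + b ^ y₁) (h₂ : 2 ^ k ∣ a ^ x₂ + b ^ y₂)
    (hlt : x₂ * y₁ < x₁ * y₂) :
    k ≤ padicValNat 2 (a ^ 2 - 1) - 1 + padicValNat 2 (x₁ * y₂ - x₂ * y₁) := by
  refine le_padicValNat_of_two_pow_dvd_pow_sub_or_add_one ha hodd (by omega) ?_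
  have cast_eq {x y : ℕ} (h : 2 ^ k ∣ a ^ x + b ^ y) :
      (a : ZMod (2 ^ k)) ^ x = -(b : ZMod (2 ^ k)) ^ y := by
    rw [← ZMod.natCast_eq_zero_iff] at h
    push_cast at h
    exact eq_neg_of_add_eq_zero_left h
  have hu : IsUnit ((a : ZMod (2 ^ k)) ^ (x₂ * y₁)) :=
    ((ZMod.isUnit_iff_coprime a (2 ^ k)).2
      (Nat.Coprime.pow_right k (Nat.coprime_two_right.2 hodd))).pow _
  have e : (a : ZMod (2 ^ k)) ^ (x₁ * y₂) =
      (a : ZMod (2 ^ k)) ^ (x₁ * y₂ - x₂ * y₁) * (a : ZMod (2 ^ k)) ^ (x₂ * y₁) := by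
    rw [← pow_add]; congr 1; omega
  have hM : (2 : ℤ) ^ k = ((2 ^ k : ℕ) : ℤ) := by push_cast; rfl
  rw [hM, ← ZMod.intCast_zmod_eq_zero_iff_dvd, ← ZMod.intCast_zmod_eq_zero_iff_dvd]
  push_cast
  rcases pow_mul_eq_or_eq_neg_of_pow_eq_neg (cast_eq h₁) (cast_eq h₂) with h | h
  · left
    rw [sub_eq_zero]
    exact hu.mul_right_cancel (by rw [← e, h, one_mul])
  · right
    exact hu.mul_right_cancel (by rw [add_mul, ← e, h]; ring)

theorem padicValNat_two_pow_add_pow {A B n : ℕ} (hA : Odd A) (hB : Odd B) (hn : Odd n) :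
    padicValNat 2 (A ^ n + B ^ n) = padicValNat 2 (A + B) := by
  have hA0 := hA.pos
  have hA' : ¬ (2 : ℤ) ∣ A := by
    rw [← even_iff_two_dvd]; exact Int.not_even_iff_odd.2 (by exact_mod_cast hA)
  have h := emultiplicity_pow_sub_pow_of_prime Int.prime_two (x := (A : ℤ)) (y := -(B : ℤ))
    (by rw [sub_neg_eq_add]; exact_mod_cast (hA.add_odd hB).two_dvd) hA' (n := n)
    (by simpa [← even_iff_two_dvd] using hn)
  rw [hn.neg_pow, sub_neg_eq_add, sub_neg_eq_add] at h
  have h' : emultiplicity 2 (A ^ n + B ^ n) = emultiplicity 2 (A + B) := by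
    rw [← Int.natCast_emultiplicity, ← Int.natCast_emultiplicity]
    exact_mod_cast h
  rw [← padicValNat_eq_emultiplicity (by positivity),
    ← padicValNat_eq_emultiplicity (by positivity)] at h'
  exact_mod_cast h'

theorem not_dvd_pow_add_pow_of_even_of_odd {A B p q M : ℕ} (hM : 2 < M) (hMB : M.Coprime B)
    (hp : Even p) (hq : Odd q) (h₁ : M ∣ A ^ p + B ^ p) : ¬ M ∣ A ^ q + B ^ q := by
  intro h₂
  rw [← ZMod.natCast_eq_zero_iff] at h₁ h₂
  push_cast at h₁ h₂
  replace h₁ := eq_neg_of_add_eq_zero_left h₁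
  replace h₂ := eq_neg_of_add_eq_zero_left h₂
  have e₁ : (A : ZMod M) ^ (p * q) = -(B : ZMod M) ^ (p * q) := by
    rw [pow_mul, h₁, hq.neg_pow, pow_mul]
  have e₂ : (A : ZMod M) ^ (p * q) = (B : ZMod M) ^ (p * q) := by
    rw [mul_comm, pow_mul, h₂, hp.neg_pow, pow_mul]
  have h : ((2 * B ^ (p * q) : ℕ) : ZMod M) = 0 := by
    push_cast
    linear_combination e₁ - e₂
  rw [ZMod.natCast_eq_zero_iff] at h
  have := Nat.le_of_dvd (by norm_num) ((hMB.pow_right _).dvd_of_dvd_mul_right h)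
  omega

theorem mul_ne_mul_of_pow_add_pow_eq_pow {a b c x₁ y₁ z₁ x₂ y₂ z₂ : ℕ}
    (ha : 1 < a) (hb : 1 < b) (hc : 1 < c)
    (haodd : Odd a) (hbodd : Odd b) (hceven : Even c) (hab : Nat.Coprime a b)
    (hx₁ : 0 < x₁) (hy₁ : 0 < y₁) (hx₂ : 0 < x₂) (hy₂ : 0 < y₂)
    (hne : (x₁, y₁, z₁) ≠ (x₂, y₂, z₂))
    (heq₁ : a ^ x₁ + b ^ y₁ = c ^ z₁) (heq₂ : a ^ x₂ + b ^ y₂ = c ^ z₂)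
    (hz : z₁ ≤ z₂) : x₁ * y₂ ≠ x₂ * y₁ := by
  intro h
  obtain ⟨g, q, p, hg, hqp, rfl, rfl⟩ := Nat.exists_coprime' (m := x₁) (n := x₂)
    (Nat.gcd_pos_of_pos_left _ hx₁)
  have hq : 0 < q := Nat.pos_of_mul_pos_right hx₁
  have hp : 0 < p := Nat.pos_of_mul_pos_right hx₂
  have h' : q * y₂ = p * y₁ := by
    apply Nat.eq_of_mul_eq_mul_left hg
    linarith
  obtain ⟨n, rfl⟩ : q ∣ y₁ := hqp.dvd_of_dvd_mul_left (Dvd.intro _ h')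
  obtain rfl : y₂ = p * n := Nat.eq_of_mul_eq_mul_left hq (by rw [h']; ring)
  have hn : 0 < n := Nat.pos_of_mul_pos_left hy₁
  have hcop : Nat.Coprime (a ^ g) (b ^ n) := hab.pow _ _
  have hAodd : Odd (a ^ g) := haodd.pow
  have hBodd : Odd (b ^ n) := hbodd.pow
  have hA : 1 < a ^ g := Nat.one_lt_pow hg.ne' ha
  have hB : 1 < b ^ n := Nat.one_lt_pow hn.ne' hb
  rw [mul_comm q g, mul_comm q n, pow_mul, pow_mul] at heq₁
  rw [mul_comm p g, mul_comm p n, pow_mul, pow_mul] at heq₂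
  generalize a ^ g = A at *
  generalize b ^ n = B at *
  have hM : 2 < c ^ z₁ := by
    have := Nat.one_lt_pow hq.ne' hA
    have := Nat.one_lt_pow hq.ne' hB
    omega
  have hMB : Nat.Coprime (c ^ z₁) B := by
    refine Nat.Coprime.coprime_dvd_right (dvd_pow_self B hq.ne') ?_
    rw [← heq₁, Nat.coprime_add_self_left]
    exact hcop.pow _ _
  have hd₁ : c ^ z₁ ∣ A ^ q + B ^ q := heq₁ ▸ dvd_rfl
  have hd₂ : c ^ z₁ ∣ A ^ p + B ^ p := heq₂ ▸ pow_dvd_pow c hz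
  rcases Nat.even_or_odd q with hqe | hqo <;> rcases Nat.even_or_odd p with hpe | hpo
  · exact Nat.not_coprime_of_dvd_of_dvd one_lt_two hqe.two_dvd hpe.two_dvd hqp
  · exact not_dvd_pow_add_pow_of_even_of_odd hM hMB hqe hpo hd₁ hd₂
  · exact not_dvd_pow_add_pow_of_even_of_odd hM hMB hpe hqo hd₂ hd₁
  · have hv : padicValNat 2 (c ^ z₁) = padicValNat 2 (c ^ z₂) := by
      rw [← heq₁, ← heq₂, padicValNat_two_pow_add_pow hAodd hBodd hqo,
        padicValNat_two_pow_add_pow hAodd hBodd hpo]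
    rw [padicValNat.pow, padicValNat.pow] at hv
    have hβ : 0 < padicValNat 2 c :=
      one_le_padicValNat_of_dvd (by omega) hceven.two_dvd
    obtain rfl := Nat.eq_of_mul_eq_mul_right hβ hv
    have hqp' : q = p := by
      rcases lt_trichotomy q p with hlt | rfl | hlt
      · have := Nat.pow_lt_pow_right hA hlt
        have := Nat.pow_lt_pow_right hB hlt
        omega
      · rfl
      · have := Nat.pow_lt_pow_right hA hlt
        have := Nat.pow_lt_pow_right hB hlt
        omega
    exact hne (by rw [hqp'])

theorem mul_log_lt_mul_log_of_pow_lt_pow {a c x z : ℕ} (ha : 0 < a) (h : a ^ x < c ^ z) :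
    (x : ℝ) * Real.log a < z * Real.log c := by
  rw [← Real.log_pow, ← Real.log_pow]
  exact Real.log_lt_log (by positivity) (by exact_mod_cast h)

theorem mul_lt_log_sq_div_of_pow_lt_pow {a b c x y z w : ℕ} (ha : 1 < a) (hb : 1 < b)
    (hx : a ^ x < c ^ z) (hy : b ^ y < c ^ w) :
    (x : ℝ) * y < z * (Real.log c ^ 2 / (Real.log a * Real.log b) * w) := by
  have hla : 0 < Real.log a := Real.log_pos (by exact_mod_cast ha)
  have hlb : 0 < Real.log b := Real.log_pos (by exact_mod_cast hb)
  have h := mul_lt_mul'' (mul_log_lt_mul_log_of_pow_lt_pow (by omega) hx)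
    (mul_log_lt_mul_log_of_pow_lt_pow (by omega) hy) (by positivity) (by positivity)
  have e : (z : ℝ) * (Real.log c ^ 2 / (Real.log a * Real.log b) * w) =
      z * Real.log c * (w * Real.log c) / (Real.log a * Real.log b) := by
    field_simp
  rw [e, lt_div_iff₀ (by positivity)]
  linarith

theorem exists_pos_lt_of_pow_add_pow_eq_pow {a b c x₁ y₁ z₁ x₂ y₂ z₂ z : ℕ}
    (ha : 1 < a) (hb : 1 < b) (haodd : Odd a) (hbodd : Odd b)
    (heq₁ : a ^ x₁ + b ^ y₁ = c ^ z₁) (heq₂ : a ^ x₂ + b ^ y₂ = c ^ z₂)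
    (hz₁ : z ≤ z₁) (hz₂ : z ≤ z₂) (hlt : x₂ * y₁ < x₁ * y₂) :
    ∃ d : ℕ, 0 < d ∧
      padicValNat 2 c * z ≤ min (padicValNat 2 (a ^ 2 - 1) - 1) (padicValNat 2 (b ^ 2 - 1) - 1) +
        padicValNat 2 d ∧
      (d : ℝ) < z₁ * (Real.log c ^ 2 / (Real.log a * Real.log b) * z₂) := by
  have hdvd {w : ℕ} (hw : z ≤ w) : 2 ^ (padicValNat 2 c * z) ∣ c ^ w := by
    rw [pow_mul]
    exact (pow_dvd_pow_of_dvd pow_padicValNat_dvd z).trans (pow_dvd_pow c hw)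
  have h₁ := heq₁ ▸ hdvd hz₁
  have h₂ := heq₂ ▸ hdvd hz₂
  refine ⟨x₁ * y₂ - x₂ * y₁, by omega, ?_, ?_⟩
  · have hA := le_padicValNat_add_of_two_pow_dvd ha haodd h₁ h₂ hlt
    have hB := le_padicValNat_add_of_two_pow_dvd (x₁ := y₂) (y₁ := x₂) (x₂ := y₁) (y₂ := x₁)
      hb hbodd (by rwa [add_comm]) (by rwa [add_comm]) (by rwa [mul_comm y₁, mul_comm y₂])
    rw [mul_comm y₂, mul_comm y₁] at hB
    omega
  · refine lt_of_le_of_lt ?_ (mul_lt_log_sq_div_of_pow_lt_pow ha hb (x := x₁) (y := y₂)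
      (by rw [← heq₁]; exact Nat.lt_add_of_pos_right (by positivity))
      (by rw [← heq₂]; exact Nat.lt_add_of_pos_left (by positivity)))
    exact_mod_cast Nat.sub_le _ _


theorem miyazaki_pink_lemma2
    (a b c : ℕ) (ha : 1 < a) (hb : 1 < b) (hc : 1 < c)
    (haodd : Odd a) (hbodd : Odd b) (hceven : Even c)
    (hab : Nat.Coprime a b)
    (α β : ℕ)
    (hα : α = min (padicValNat 2 (a ^ 2 - 1) - 1) (padicValNat 2 (b ^ 2 - 1) - 1))
    (hβ : β = padicValNat 2 c)
    (x₁ y₁ z₁ x₂ y₂ z₂ : ℕ)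
    (hx₁ : 0 < x₁) (hy₁ : 0 < y₁) (hz₁ : 0 < z₁)
    (hx₂ : 0 < x₂) (hy₂ : 0 < y₂) (hz₂ : 0 < z₂)
    (hne : (x₁, y₁, z₁) ≠ (x₂, y₂, z₂))
    (heq₁ : a ^ x₁ + b ^ y₁ = c ^ z₁) (heq₂ : a ^ x₂ + b ^ y₂ = c ^ z₂)
    (hz : z₁ ≤ z₂) :
    (β : ℝ) * z₁ - Real.log z₁ / Real.log 2 < (α : ℝ) +
      (1 / Real.log 2) *
        Real.log ((Real.log c) ^ 2 / (Real.log a * Real.log b) * z₂) := by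
  have hmul : x₁ * y₂ ≠ x₂ * y₁ := mul_ne_mul_of_pow_add_pow_eq_pow ha hb hc haodd hbodd hceven
    hab hx₁ hy₁ hx₂ hy₂ hne heq₁ heq₂ hz
  obtain ⟨d, hd, hle, hlt⟩ : ∃ d : ℕ, 0 < d ∧ β * z₁ ≤ α + padicValNat 2 d ∧
      (d : ℝ) < z₁ * (Real.log c ^ 2 / (Real.log a * Real.log b) * z₂) := by
    rw [hα, hβ]
    rcases hmul.lt_or_gt with h | h
    · obtain ⟨d, hd, hle, hlt⟩ := exists_pos_lt_of_pow_add_pow_eq_pow ha hb haodd hbodd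
        heq₂ heq₁ hz le_rfl h
      exact ⟨d, hd, hle, hlt.trans_eq (by ring)⟩
    · exact exists_pos_lt_of_pow_add_pow_eq_pow ha hb haodd hbodd heq₁ heq₂ le_rfl hz h
  have hd' : (0 : ℝ) < d := by exact_mod_cast hd
  have hz₁' : (0 : ℝ) < z₁ := by exact_mod_cast hz₁
  have hl2 : 0 < Real.log 2 := Real.log_pos one_lt_two
  have hpos : 0 < Real.log c ^ 2 / (Real.log a * Real.log b) * z₂ :=
    (mul_pos_iff_of_pos_left hz₁').1 (hd'.trans hlt)
  have hlog := Real.log_lt_log hd' hlt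
  rw [Real.log_mul hz₁'.ne' hpos.ne'] at hlog
  have hval : (padicValNat 2 d : ℝ) * Real.log 2 ≤ Real.log d := by
    rw [← Real.log_pow]
    exact Real.log_le_log (by positivity)
      (by exact_mod_cast Nat.le_of_dvd hd pow_padicValNat_dvd)
  have hle' : (β : ℝ) * z₁ ≤ α + padicValNat 2 d := by exact_mod_cast hle
  rw [sub_lt_iff_lt_add, add_assoc, one_div_mul_eq_div, ← add_div]
  refine hle'.trans_lt (add_lt_add_right ?_ _)
  rw [lt_div_iff₀ hl2]
  linarith
end
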